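/- Let μ ∈ ℝ^d and define the random vector X = μ + √W · A Z. Then the law of X is absolutely continuous with respect to Lebesgue measure on ℝ^d with density f(x) = ∫₀^∞ (2πw)^(−d/2) (det Σ)^(−1/2) exp(−D²(x; μ, Σ)/(2w)) dρ_W(w), where ρ_W is the law of W; i.e., the pushforward of ℙ under X equals Lebesgue measure on ℝ^d with density f. -/

import Mathlib

open Real Set Matrix MeasureTheory ProbabilityTheory

lemma pi_gauss_aux (d : ℕ) :
    (Measure.pi fun _ : Fin d => gaussianReal 0 1) =
      volume.withDensity fun z : Fin d → ℝ => ENNReal.ofReal (∏ i, gaussianPDFReal 0 1 (z i)) := by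
  apply Measure.pi_eq
  intro s hs
  rw [withDensity_apply _ (MeasurableSet.univ_pi hs), volume_pi, Measure.restrict_pi_pi,
    ← ofReal_integral_eq_lintegral_ofReal, integral_fintype_prod_eq_prod,
    ENNReal.ofReal_prod_of_nonneg]
  · refine Finset.prod_congr rfl fun i _ => ?_
    rw [gaussianReal_of_var_ne_zero 0 one_ne_zero, withDensity_apply _ (hs i),
      ofReal_integral_eq_lintegral_ofReal]
    · rfl
    · exact (integrable_gaussianPDFReal 0 1).restrict
    · exact ae_of_all _ fun x => gaussianPDFReal_nonneg 0 1 x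
  · intro i _
    exact integral_nonneg fun x => gaussianPDFReal_nonneg 0 1 x
  · exact Integrable.fintype_prod fun i => (integrable_gaussianPDFReal 0 1).restrict
  · exact ae_of_all _ fun x => Finset.prod_nonneg fun i _ => gaussianPDFReal_nonneg 0 1 _

lemma quad_aux {d : ℕ} (A : Matrix (Fin d) (Fin d) ℝ) (hA : IsUnit A.det) (c : ℝ)
    (z : Fin d → ℝ) :
    (c • A *ᵥ z) ⬝ᵥ ((A * Aᵀ)⁻¹ *ᵥ (c • A *ᵥ z)) = c ^ 2 * (z ⬝ᵥ z) := by
  have hAT : IsUnit (Aᵀ).det := by rwa [det_transpose]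
  have h1 : (A * Aᵀ)⁻¹ *ᵥ (A *ᵥ z) = (Aᵀ)⁻¹ *ᵥ z := by
    rw [Matrix.mul_inv_rev, mulVec_mulVec, Matrix.mul_assoc, Matrix.nonsing_inv_mul _ hA,
      Matrix.mul_one]
  have h2 : (A *ᵥ z) ⬝ᵥ ((Aᵀ)⁻¹ *ᵥ z) = z ⬝ᵥ z := by
    rw [← vecMul_transpose, ← dotProduct_mulVec, mulVec_mulVec, Matrix.mul_nonsing_inv _ hAT,
      one_mulVec]
  rw [mulVec_smul, smul_dotProduct, dotProduct_smul, h1, h2]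
  simp only [smul_eq_mul]
  ring

lemma dens_aux {d : ℕ} (A : Matrix (Fin d) (Fin d) ℝ) (hA : IsUnit A.det) (w : ℝ) (hw : 0 < w)
    (z : Fin d → ℝ) :
    ∏ i, gaussianPDFReal 0 1 (z i) = |(√w • A).det| *
      ((2 * π * w) ^ (-(d : ℝ) / 2) * (A * Aᵀ).det ^ (-(1 : ℝ) / 2) *
        Real.exp (-((√w • A *ᵥ z) ⬝ᵥ ((A * Aᵀ)⁻¹ *ᵥ (√w • A *ᵥ z))) / (2 * w))) := by
  have hA0 : A.det ≠ 0 := hA.ne_zero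
  rw [quad_aux A hA, Real.sq_sqrt hw.le]
  simp only [gaussianPDFReal, Finset.prod_mul_distrib, ← Real.exp_sum, Finset.prod_const,
    Finset.card_univ, Fintype.card_fin, sub_zero, NNReal.coe_one, mul_one]
  have e1 : ∑ i, -(z i) ^ 2 / 2 = -(w * (z ⬝ᵥ z)) / (2 * w) := by
    rw [neg_div, show w * (z ⬝ᵥ z) / (2 * w) = (z ⬝ᵥ z) / 2 by field_simp, dotProduct, Finset.sum_div, ← Finset.sum_neg_distrib]
    refine Finset.sum_congr rfl fun i _ => ?_
    ring
  rw [e1, ← mul_assoc]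
  congr 1
  have e2 : (A * Aᵀ).det ^ (-(1 : ℝ) / 2) = |A.det|⁻¹ := by
    rw [det_mul, det_transpose, ← abs_mul_abs_self, neg_div, Real.rpow_neg (by positivity),
      ← Real.sqrt_eq_rpow, Real.sqrt_mul_self (abs_nonneg _)]
  have e3 : (2 * π * w) ^ (-(d : ℝ) / 2) = (√(2 * π))⁻¹ ^ d * (√w)⁻¹ ^ d := by
    rw [← mul_pow, ← mul_inv, ← Real.sqrt_mul (by positivity), Real.sqrt_eq_rpow,
      ← Real.rpow_neg (by positivity), ← Real.rpow_natCast, ← Real.rpow_mul (by positivity)]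
    congr 1
    ring
  have hs : 0 < √w := Real.sqrt_pos.2 hw
  have : |A.det| ≠ 0 := abs_ne_zero.2 hA0
  rw [e2, e3, det_smul, abs_mul, abs_pow, abs_of_pos hs, Fintype.card_fin]
  have h1 : √w ^ d * (√w)⁻¹ ^ d = 1 := by
    rw [← mul_pow, mul_inv_cancel₀ hs.ne', one_pow]
  have h2 : |A.det| * |A.det|⁻¹ = 1 := mul_inv_cancel₀ this
  calc (√(2 * π))⁻¹ ^ d = (√(2 * π))⁻¹ ^ d * (√w ^ d * (√w)⁻¹ ^ d) * (|A.det| * |A.det|⁻¹) := by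
        rw [h1, h2]; ring
    _ = _ := by ring

lemma change_aux {d : ℕ} (A : Matrix (Fin d) (Fin d) ℝ) (hA : IsUnit A.det) (w : ℝ) (hw : 0 < w)
    (μ : Fin d → ℝ) (g : (Fin d → ℝ) → ENNReal) (hg : Measurable g) :
    ∫⁻ z, g (μ + √w • A *ᵥ z) ∂(Measure.pi fun _ : Fin d => gaussianReal 0 1) =
    ∫⁻ x, ENNReal.ofReal ((2 * π * w) ^ (-(d : ℝ) / 2) * (A * Aᵀ).det ^ (-(1 : ℝ) / 2) *
        Real.exp (-((x - μ) ⬝ᵥ ((A * Aᵀ)⁻¹ *ᵥ (x - μ))) / (2 * w))) * g x := by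
  set M := √w • A with hM
  have hs : 0 < √w := Real.sqrt_pos.2 hw
  have hMd : M.det ≠ 0 := by
    rw [hM, det_smul]
    exact mul_ne_zero (pow_ne_zero _ hs.ne') hA.ne_zero
  set k : (Fin d → ℝ) → ℝ := fun y => (2 * π * w) ^ (-(d : ℝ) / 2) *
    (A * Aᵀ).det ^ (-(1 : ℝ) / 2) * Real.exp (-(y ⬝ᵥ ((A * Aᵀ)⁻¹ *ᵥ y)) / (2 * w)) with hk
  have hkc : Continuous k := by
    have : Continuous fun y : Fin d → ℝ => y ⬝ᵥ ((A * Aᵀ)⁻¹ *ᵥ y) :=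
      continuous_id.dotProduct (continuous_const.matrix_mulVec continuous_id)
    rw [hk]; fun_prop
  have hkm : Measurable k := hkc.measurable
  have hpdf : Measurable fun z : Fin d → ℝ =>
      ENNReal.ofReal (∏ i, gaussianPDFReal 0 1 (z i)) := by
    refine ENNReal.measurable_ofReal.comp (Finset.measurable_prod _ fun i _ => ?_)
    exact (measurable_gaussianPDFReal 0 1).comp (measurable_pi_apply i)
  have hMv : ∀ z, √w • A *ᵥ z = toLin' M z := fun z => by
    rw [toLin'_apply, hM, smul_mulVec]
  have hlin : Measurable (toLin' M) := (toLin' M).continuous_of_finiteDimensional.measurable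
  have hgT : Measurable fun z => g (μ + √w • A *ᵥ z) := by
    simp_rw [hMv]
    exact hg.comp (measurable_const.add hlin)
  rw [pi_gauss_aux, lintegral_withDensity_eq_lintegral_mul _ hpdf hgT]
  have step : ∀ z : Fin d → ℝ, ENNReal.ofReal (∏ i, gaussianPDFReal 0 1 (z i)) *
      g (μ + √w • A *ᵥ z) = (fun y => ENNReal.ofReal |M.det| *
        (ENNReal.ofReal (k y) * g (μ + y))) (toLin' M z) := by
    intro z
    rw [dens_aux A hA w hw z, ENNReal.ofReal_mul (abs_nonneg _), hMv, mul_assoc]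
  have hgm : Measurable fun y => ENNReal.ofReal (k y) * g (μ + y) :=
    (ENNReal.measurable_ofReal.comp hkm).mul (hg.comp (measurable_const.add measurable_id))
  simp only [Pi.mul_apply, Function.comp_apply]
  rw [lintegral_congr step, ← lintegral_map (hgm.const_mul _) hlin,
    Real.map_matrix_volume_pi_eq_smul_volume_pi hMd, lintegral_smul_measure,
    lintegral_const_mul _ hgm, smul_eq_mul, ← mul_assoc, ← ENNReal.ofReal_mul (abs_nonneg _),
    ← abs_mul, inv_mul_cancel₀ hMd, abs_one, ENNReal.ofReal_one, one_mul,
    ← lintegral_sub_right_eq_self _ μ]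
  refine lintegral_congr fun x => ?_
  simp only [add_sub_cancel]
  rfl

/-- The normal variance mixture `X = μ + √W · A Z` (with `W > 0` a.s.
independent of the standard Gaussian vector `Z` and `Σ = A Aᵀ`) has law absolutely
continuous with respect to Lebesgue measure on `ℝ^d`, with density
`f(x) = ∫₀^∞ (2πw)^(-d/2) (det Σ)^(-1/2) exp(-D²(x; μ, Σ)/(2w)) dρ_W(w)`. -/
theorem stmt_10 (d : ℕ) (hd : 1 ≤ d)
    {Ω : Type*} [MeasureSpace Ω] [IsProbabilityMeasure (ℙ : Measure Ω)]
    (W : Ω → ℝ) (hW : Measurable W) (hWpos : ∀ᵐ ω ∂ℙ, 0 < W ω)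
    (Z : Ω → Fin d → ℝ) (hZ : Measurable Z)
    (hZlaw : Measure.map Z ℙ = Measure.pi fun _ : Fin d => gaussianReal 0 1)
    (hindep : IndepFun W Z ℙ)
    (A : Matrix (Fin d) (Fin d) ℝ) (hA : IsUnit A.det)
    (S : Matrix (Fin d) (Fin d) ℝ) (hSdef : S = A * Aᵀ)
    (μ : Fin d → ℝ)
    (X : Ω → Fin d → ℝ)
    (hX : ∀ ω, X ω = μ + Real.sqrt (W ω) • A.mulVec (Z ω))
    (f : (Fin d → ℝ) → ℝ)
    (hf : ∀ x, f x = ∫ w, (2 * π * w) ^ (-(d : ℝ) / 2) * S.det ^ (-(1 : ℝ) / 2) *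
        Real.exp (-((x - μ) ⬝ᵥ (S⁻¹ *ᵥ (x - μ))) / (2 * w)) ∂(Measure.map W ℙ)) :
    Measure.map X ℙ = volume.withDensity fun x => ENNReal.ofReal (f x) := by
  subst hSdef
  set ρ := Measure.map W ℙ with hρ
  have : IsProbabilityMeasure ρ := Measure.isProbabilityMeasure_map hW.aemeasurable
  have hρpos : ∀ᵐ w ∂ρ, 0 < w := (ae_map_iff hW.aemeasurable measurableSet_Ioi).2 hWpos
  set K : ℝ → (Fin d → ℝ) → ℝ := fun w x => (2 * π * w) ^ (-(d : ℝ) / 2) *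
    (A * Aᵀ).det ^ (-(1 : ℝ) / 2) *
    Real.exp (-((x - μ) ⬝ᵥ ((A * Aᵀ)⁻¹ *ᵥ (x - μ))) / (2 * w)) with hK
  have hKm : Measurable (Function.uncurry K) := by
    have hq : Measurable fun x : Fin d → ℝ => (x - μ) ⬝ᵥ ((A * Aᵀ)⁻¹ *ᵥ (x - μ)) := by
      have : Continuous fun x : Fin d → ℝ => (x - μ) ⬝ᵥ ((A * Aᵀ)⁻¹ *ᵥ (x - μ)) :=
        (continuous_id.sub continuous_const).dotProduct
          (continuous_const.matrix_mulVec (continuous_id.sub continuous_const))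
      exact this.measurable
    have hq2 := hq.comp (measurable_snd : Measurable (Prod.snd : ℝ × (Fin d → ℝ) → _))
    simp only [Function.comp_def] at hq2
    simp only [hK, Function.uncurry_def]
    fun_prop
  have hdet : 0 ≤ (A * Aᵀ).det := by
    rw [det_mul, det_transpose]; exact mul_self_nonneg _
  have hKnn : ∀ x, 0 ≤ᵐ[ρ] fun w => K w x := fun x => by
    filter_upwards [hρpos] with w hw
    have := Real.rpow_nonneg hdet (-(1 : ℝ) / 2)
    simp only [hK, Pi.zero_apply]
    positivity
  have hKo : Measurable (Function.uncurry fun w x => ENNReal.ofReal (K w x)) :=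
    ENNReal.measurable_ofReal.comp hKm
  have hT : Measurable fun p : ℝ × (Fin d → ℝ) => μ + √p.1 • A *ᵥ p.2 := by
    have : Continuous fun p : ℝ × (Fin d → ℝ) => μ + √p.1 • A *ᵥ p.2 :=
      continuous_const.add ((Real.continuous_sqrt.comp continuous_fst).smul
        (continuous_const.matrix_mulVec continuous_snd))
    exact this.measurable
  have hXe : X = (fun p : ℝ × (Fin d → ℝ) => μ + √p.1 • A *ᵥ p.2) ∘ fun ω => (W ω, Z ω) := by
    funext ω
    exact hX ω
  have hXm : Measurable X := by
    rw [hXe]; exact hT.comp (hW.prodMk hZ)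
  have key : ∀ s, MeasurableSet s → Measure.map X ℙ s =
      ∫⁻ x in s, ∫⁻ w, ENNReal.ofReal (K w x) ∂ρ := by
    intro s hs
    have hg : Measurable (s.indicator (1 : (Fin d → ℝ) → ENNReal)) := measurable_one.indicator hs
    have hgT : Measurable fun p : ℝ × (Fin d → ℝ) =>
        s.indicator (1 : (Fin d → ℝ) → ENNReal) (μ + √p.1 • A *ᵥ p.2) := hg.comp hT
    rw [← lintegral_indicator_one hs, hXe, ← Measure.map_map hT (hW.prodMk hZ),
      (indepFun_iff_map_prod_eq_prod_map_map hW.aemeasurable hZ.aemeasurable).1 hindep,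
      lintegral_map hg hT, hZlaw, lintegral_prod _ hgT.aemeasurable,
      ← lintegral_indicator hs]
    have h1 : ∀ᵐ w ∂ρ, (∫⁻ z, s.indicator (1 : (Fin d → ℝ) → ENNReal) (μ + √w • A *ᵥ z)
        ∂(Measure.pi fun _ : Fin d => gaussianReal 0 1)) =
        ∫⁻ x, ENNReal.ofReal (K w x) * s.indicator 1 x := by
      filter_upwards [hρpos] with w hw
      exact change_aux A hA w hw μ _ hg
    rw [lintegral_congr_ae h1, lintegral_lintegral_swap
      ((hKo.mul (hg.comp measurable_snd)).aemeasurable)]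
    refine lintegral_congr fun x => ?_
    by_cases hx : x ∈ s <;> simp [hx]
  have hPX : IsProbabilityMeasure (Measure.map X ℙ) :=
    Measure.isProbabilityMeasure_map hXm.aemeasurable
  have hin : Measurable fun x => ∫⁻ w, ENNReal.ofReal (K w x) ∂ρ := hKo.lintegral_prod_left
  have hfin : ∀ᵐ x, (∫⁻ w, ENNReal.ofReal (K w x) ∂ρ) < ⊤ := by
    refine ae_lt_top hin ?_
    rw [← setLIntegral_univ, ← key _ MeasurableSet.univ]
    exact measure_ne_top _ _
  have hfe : (fun x => ENNReal.ofReal (f x)) =ᵐ[volume]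
      fun x => ∫⁻ w, ENNReal.ofReal (K w x) ∂ρ := by
    filter_upwards [hfin] with x hx
    rw [hf x]
    refine ofReal_integral_eq_lintegral_ofReal ⟨?_, ?_⟩ (hKnn x)
    · exact (hKm.comp (measurable_id.prodMk measurable_const)).aestronglyMeasurable
    · exact (hasFiniteIntegral_iff_ofReal (hKnn x)).2 hx
  rw [withDensity_congr_ae hfe]
  ext s hs
  rw [withDensity_apply _ hs, key s hs]
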